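/- Let (G,ρ) be a group with a two-sided invariant metric ρ, complete with respect to ρ, let c : Γ × ∂Γ → G be a Hölder continuous cocycle with exponent τ satisfying c(g,g⁺) = c(g,g⁻) = e for every infinite order element g ∈ Γ, and let g ∈ Γ be of infinite order. For ξ ∈ ∂Γ∖{g⁻} set b_{g,n}(ξ) = c(g⁻ⁿ,ξ). Then the sequence {b_{g,n}}_{n≥1} converges to a map b_g : ∂Γ∖{g⁻} → G uniformly on every compact subset of ∂Γ∖{g⁻}; moreover, for every r > 0 there is a constant C'(g,r) > 0 such that ρ(b_g(ξ),b_g(η)) ≤ C'(g,r)·τ^{(ξ|η)} for all ξ, η ∈ ∂Γ∖V_r(g⁻). -/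

import Mathlib

open Filter Topology MeasureTheory
open scoped ENNReal

namespace HarmonicBoundary

variable {Γ : Type} [Group Γ]

/-- Word length of `g` with respect to a generating set `S`. -/
noncomputable def wl (S : Set Γ) (g : Γ) : ℕ :=
  sInf {n : ℕ | ∃ w : List Γ, w.length = n ∧ (∀ x ∈ w, x ∈ S) ∧ w.prod = g}

/-- Word metric `d(x,y) = |x⁻¹y|`. -/
noncomputable def wdist (S : Set Γ) (x y : Γ) : ℕ := wl S (x⁻¹ * y)

/-- Gromov product `(x|y)_z = (d(x,z)+d(y,z)-d(x,y))/2`. -/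
noncomputable def gp (S : Set Γ) (z x y : Γ) : ℝ :=
  ((wdist S x z : ℝ) + (wdist S y z : ℝ) - (wdist S x y : ℝ)) / 2

/-- `S` is a finite symmetric generating set of `Γ`. -/
def IsGenSet (S : Set Γ) : Prop :=
  S.Finite ∧ (∀ s ∈ S, s⁻¹ ∈ S) ∧ Subgroup.closure S = ⊤

/-- `Γ` is `δ`-hyperbolic with respect to the word metric of `S`:
`(x|y) ≥ min ((x|z), (y|z)) - δ` for all `x y z`. -/
def IsHyperbolic (S : Set Γ) (δ : ℝ) : Prop :=
  0 ≤ δ ∧ ∀ x y z : Γ, min (gp S 1 x z) (gp S 1 y z) - δ ≤ gp S 1 x y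

/-- `Γ` is nonelementary: it has no cyclic subgroup of finite index. -/
def Nonelementary (Γ : Type) [Group Γ] : Prop :=
  ∀ g : Γ, (Subgroup.zpowers g).index = 0

/-- A sequence converges to infinity if `(x_i|x_j) → ∞`. -/
def ConvInf (S : Set Γ) (u : ℕ → Γ) : Prop :=
  Tendsto (fun p : ℕ × ℕ => gp S 1 (u p.1) (u p.2)) atTop atTop

/-- Two sequences converging to infinity are equivalent if `(x_i|y_j) → ∞`. -/
def EquivSeq (S : Set Γ) (u v : ℕ → Γ) : Prop :=
  Tendsto (fun p : ℕ × ℕ => gp S 1 (u p.1) (v p.2)) atTop atTop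

/-- An (abstract model of the) Gromov boundary of `Γ`: the points are exactly the
classes of sequences converging to infinity, modulo the equivalence `EquivSeq`,
together with the natural left action of `Γ`. -/
structure Boundary (Γ : Type) [Group Γ] (S : Set Γ) where
  pt : Type
  cls : (ℕ → Γ) → pt
  cls_surj : ∀ ξ : pt, ∃ u : ℕ → Γ, ConvInf S u ∧ cls u = ξ
  cls_eq : ∀ u v : ℕ → Γ, ConvInf S u → ConvInf S v → (cls u = cls v ↔ EquivSeq S u v)
  smul : Γ → pt → pt
  smul_cls : ∀ (g : Γ) (u : ℕ → Γ), ConvInf S u → smul g (cls u) = cls fun n => g * u n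

/-- Extension of the Gromov product to the boundary:
`(ξ|η) = sup liminf (x_i|y_j)` over sequences representing `ξ` and `η`,
as an extended nonnegative real. -/
noncomputable def bgp {S : Set Γ} (B : Boundary Γ S) (ξ η : B.pt) : ℝ≥0∞ :=
  ⨆ (u : {u : ℕ → Γ // ConvInf S u ∧ B.cls u = ξ})
    (v : {v : ℕ → Γ // ConvInf S v ∧ B.cls v = η}),
    Filter.liminf (fun p : ℕ × ℕ => ENNReal.ofReal (gp S 1 (u.1 p.1) (v.1 p.2))) atTop

/-- Real-valued Gromov product on the boundary (finite for `ξ ≠ η`). -/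
noncomputable def bgpR {S : Set Γ} (B : Boundary Γ S) (ξ η : B.pt) : ℝ := (bgp B ξ η).toReal

/-- The canonical topology of the Gromov boundary: a set is open iff around each of
its points it contains a basic neighbourhood `V_r(p) = {q | (q|p) > r}`. -/
def btop {S : Set Γ} (B : Boundary Γ S) : TopologicalSpace B.pt where
  IsOpen O := ∀ p ∈ O, ∃ r : ℝ≥0∞, r ≠ ⊤ ∧ {q | r < bgp B q p} ⊆ O
  isOpen_univ := fun p _ => ⟨0, ENNReal.zero_ne_top, fun q _ => trivial⟩
  isOpen_inter := by
    intro A A' hA hA' p hp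
    obtain ⟨r1, hr1, h1⟩ := hA p hp.1
    obtain ⟨r2, hr2, h2⟩ := hA' p hp.2
    refine ⟨max r1 r2, (max_lt hr1.lt_top hr2.lt_top).ne, fun q hq => ?_⟩
    have hq' : max r1 r2 < bgp B q p := hq
    exact ⟨h1 (show r1 < bgp B q p from (le_max_left r1 r2).trans_lt hq'),
      h2 (show r2 < bgp B q p from (le_max_right r1 r2).trans_lt hq')⟩
  isOpen_sUnion := by
    intro s hs p hp
    obtain ⟨t, ht, hpt⟩ := hp
    obtain ⟨r, hr, hsub⟩ := hs t ht p hpt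
    exact ⟨r, hr, fun q hq => ⟨t, ht, hsub hq⟩⟩

/-- The attracting fixed point `g⁺ = lim_n gⁿ` of an (infinite order) element. -/
def plusPt {S : Set Γ} (B : Boundary Γ S) (g : Γ) : B.pt := B.cls fun n => g ^ n

/-- The repelling fixed point `g⁻ = lim_n g⁻ⁿ` of an (infinite order) element. -/
def minusPt {S : Set Γ} (B : Boundary Γ S) (g : Γ) : B.pt := B.cls fun n => g⁻¹ ^ n

/-- A geodesic ray starting at the identity. -/
def IsGeodesicRay (S : Set Γ) (x : ℕ → Γ) : Prop :=
  x 0 = 1 ∧ ∀ m n : ℕ, wdist S (x m) (x n) = Nat.dist m n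

/-- A geodesic ray from `e` to the boundary point `ξ`, i.e. an element of `[e,ξ]`. -/
def RayTo {S : Set Γ} (B : Boundary Γ S) (x : ℕ → Γ) (ξ : B.pt) : Prop :=
  IsGeodesicRay S x ∧ ConvInf S x ∧ B.cls x = ξ

/-- A geodesic segment from `x` to `y` (parametrized on `0,…,d(x,y)`),
i.e. an element of `[x,y]`. -/
def IsGeodesicSeg (S : Set Γ) (x y : Γ) (α : ℕ → Γ) : Prop :=
  α 0 = x ∧ α (wdist S x y) = y ∧
  ∀ m n : ℕ, m ≤ wdist S x y → n ≤ wdist S x y → wdist S (α m) (α n) = Nat.dist m n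

/-- The boundary "cylinder" `U(ξ,R)`: all `η` such that for every pair of geodesic
rays `x ∈ [e,ξ]`, `y ∈ [e,η]` one has `lim_n (x(n)|y(n)) > R` (the sequence
`(x(n)|y(n))` is nondecreasing, so the limit exceeds `R` iff some term does). -/
def Uset {S : Set Γ} (B : Boundary Γ S) (ξ : B.pt) (R : ℝ) : Set B.pt :=
  {η | ∀ x y : ℕ → Γ, RayTo B x ξ → RayTo B y η → ∃ n : ℕ, R < gp S 1 (x n) (y n)}

/-- `C_r(p) = {g | (g|e)_p > r}`. -/
def Cset (S : Set Γ) (p : Γ) (r : ℝ) : Set Γ := {g | r < gp S p g 1}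

/-- The `R`-neighbourhood `N(α,R)` of a geodesic segment `α ∈ [x,y]`. -/
def segN (S : Set Γ) (x y : Γ) (α : ℕ → Γ) (R : ℝ) : Set Γ :=
  {g | ∃ i ≤ wdist S x y, (wdist S g (α i) : ℝ) ≤ R}

/-- The `R`-neighbourhood `N(A,R)` of a subset `A ⊆ Γ`. -/
def setN (S : Set Γ) (A : Set Γ) (R : ℝ) : Set Γ :=
  {g | ∃ a ∈ A, (wdist S g a : ℝ) ≤ R}

/-- `μ` is a nondegenerate probability measure on `Γ` with support contained in `S`:
nonnegative, of total mass one, supported in `S`, and the semigroup generated by its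
support is the whole of `Γ`. -/
structure IsRWMeasure (S : Set Γ) (μ : Γ → ℝ) : Prop where
  nonneg : ∀ g, 0 ≤ μ g
  support_subset : ∀ g, μ g ≠ 0 → g ∈ S
  total : ∑' g : Γ, μ g = 1
  nondeg : ∀ g : Γ, ∃ l : List Γ, l ≠ [] ∧ (∀ x ∈ l, 0 < μ x) ∧ l.prod = g

open Classical in
/-- `n`-step transition probabilities `p⁽ⁿ⁾(x,y) = μ*ⁿ(x⁻¹y)` of the random walk. -/
noncomputable def ptrans (μ : Γ → ℝ) : ℕ → Γ → Γ → ℝ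
  | 0 => fun x y => if x = y then 1 else 0
  | n + 1 => fun x y => ∑' z : Γ, ptrans μ n x z * μ (z⁻¹ * y)

/-- Green function `G(x,y) = Σ_n p⁽ⁿ⁾(x,y)`. -/
noncomputable def green (μ : Γ → ℝ) (x y : Γ) : ℝ := ∑' n : ℕ, ptrans μ n x y

/-- `F(x,y) = G(x,y)/G(y,y)`, the probability that the walk from `x` ever hits `y`. -/
noncomputable def greenF (μ : Γ → ℝ) (x y : Γ) : ℝ := green μ x y / green μ y y

/-- The Martin kernel `K(x,y) = G(x,y)/G(e,y)`. -/
noncomputable def martinK (μ : Γ → ℝ) (x y : Γ) : ℝ := green μ x y / green μ 1 y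

open Classical in
/-- Transition probabilities of the walk restricted to `Δ` (killed when leaving `Δ`). -/
noncomputable def ptransR (μ : Γ → ℝ) (Δ : Set Γ) : ℕ → Γ → Γ → ℝ
  | 0 => fun x y => if x = y ∧ x ∈ Δ then 1 else 0
  | n + 1 => fun x y => if y ∈ Δ then ∑' z : Γ, ptransR μ Δ n x z * μ (z⁻¹ * y) else 0

/-- Green function `G_Δ` of the restricted walk. -/
noncomputable def greenR (μ : Γ → ℝ) (Δ : Set Γ) (x y : Γ) : ℝ := ∑' n : ℕ, ptransR μ Δ n x y

/-- `F_Δ(x,y) = G_Δ(x,y)/G_Δ(y,y)`. -/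
noncomputable def greenFR (μ : Γ → ℝ) (Δ : Set Γ) (x y : Γ) : ℝ :=
  greenR μ Δ x y / greenR μ Δ y y

/-- Generating function `G_Δ(x,y|z) = Σ_n p_Δ⁽ⁿ⁾(x,y) zⁿ`. -/
noncomputable def greenRZ (μ : Γ → ℝ) (Δ : Set Γ) (x y : Γ) (z : ℝ) : ℝ :=
  ∑' n : ℕ, ptransR μ Δ n x y * z ^ n

/-- Spectral radius `ρ(P) = lim_n p⁽ⁿ⁾(e,e)^{1/n}` of the walk. -/
noncomputable def specRad (μ : Γ → ℝ) : ℝ :=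
  Filter.limsup (fun n : ℕ => (ptrans μ n 1 1) ^ ((n : ℝ)⁻¹)) atTop

/-- `u` is harmonic on `Λ`: `Σ_h p(g,h) u(h) = u(g)` for `g ∈ Λ`, `p(g,h)=μ(g⁻¹h)`. -/
def HarmonicOn (μ : Γ → ℝ) (u : Γ → ℝ) (Λ : Set Γ) : Prop :=
  ∀ g ∈ Λ, (∑' h : Γ, μ (g⁻¹ * h) * u h) = u g

/-- `u` vanishes at infinity on `Λ`: `u(g_n) → 0` along sequences in `Λ` with `|g_n|→∞`. -/
def VanishesAtInftyOn (S : Set Γ) (u : Γ → ℝ) (Λ : Set Γ) : Prop :=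
  ∀ ε : ℝ, 0 < ε → ∃ M : ℕ, ∀ g ∈ Λ, M ≤ wl S g → |u g| ≤ ε

open Classical in
/-- `r(g) = K(g⁻¹,g⁺)` for infinite order `g`, and `r(g) = 1` for finite order `g`;
here `Kb` is the boundary extension of the Martin kernel. -/
noncomputable def rfun {S : Set Γ} (B : Boundary Γ S) (Kb : Γ → B.pt → ℝ) (g : Γ) : ℝ :=
  if IsOfFinOrder g then 1 else Kb g⁻¹ (plusPt B g)

/-- The ratio set `r(Γ,∂Γ,ν)`: all `l ≥ 0` such that for every `ε > 0` and every
Borel `A` of positive measure there is `g ∈ Γ` such that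
`{ω ∈ gA ∩ A : |d(gν)/dν(ω) − l| < ε}` has positive measure; here the
Radon–Nikodym derivative `d(gν)/dν` is the Martin kernel `Kb g`. -/
def ratioSet {S : Set Γ} (B : Boundary Γ S) [MeasurableSpace B.pt]
    (ν : Measure B.pt) (Kb : Γ → B.pt → ℝ) : Set ℝ :=
  {l : ℝ | 0 ≤ l ∧ ∀ ε : ℝ, 0 < ε → ∀ A : Set B.pt, MeasurableSet A → 0 < ν A →
    ∃ g : Γ, 0 < ν {ω | ω ∈ A ∧ B.smul g⁻¹ ω ∈ A ∧ |Kb g ω - l| < ε}}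

/-- A left invariant finitely additive mean on `Γ`; `Γ` is amenable iff one exists. -/
structure InvariantMean (Γ : Type) [Group Γ] where
  m : Set Γ → ℝ
  nonneg : ∀ A, 0 ≤ m A
  total : m Set.univ = 1
  fin_add : ∀ A B : Set Γ, Disjoint A B → m (A ∪ B) = m A + m B
  invariant : ∀ (g : Γ) (A : Set Γ), m ((g * ·) ⁻¹' A) = m A


section Helpers

theorem wl_word {S : Set Γ} (hS : IsGenSet S) (g : Γ) :
    ∃ w : List Γ, w.length = wl S g ∧ (∀ x ∈ w, x ∈ S) ∧ w.prod = g := by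
  have hmem : g ∈ Subgroup.closure S := by rw [hS.2.2]; trivial
  have : ∃ w : List Γ, (∀ x ∈ w, x ∈ S) ∧ w.prod = g := by
    induction hmem using Subgroup.closure_induction with
    | mem x hx => exact ⟨[x], by simpa using hx, by simp⟩
    | one => exact ⟨[], by simp, by simp⟩
    | mul x y _ _ ihx ihy =>
      obtain ⟨w, hw, rfl⟩ := ihx
      obtain ⟨v, hv, rfl⟩ := ihy
      refine ⟨w ++ v, ?_, by simp⟩
      intro z hz
      rcases List.mem_append.1 hz with h | h
      · exact hw z h
      · exact hv z h
    | inv x _ ihx =>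
      obtain ⟨w, hw, rfl⟩ := ihx
      refine ⟨(w.map (·⁻¹)).reverse, ?_, by rw [List.prod_inv_reverse]⟩
      intro z hz
      simp only [List.mem_reverse, List.mem_map] at hz
      obtain ⟨y, hy, rfl⟩ := hz
      exact hS.2.1 y (hw y hy)
  obtain ⟨w, hw, hp⟩ := this
  have hn : {n : ℕ | ∃ w : List Γ, w.length = n ∧ (∀ x ∈ w, x ∈ S) ∧ w.prod = g}.Nonempty :=
    ⟨w.length, w, rfl, hw, hp⟩
  exact Nat.sInf_mem hn

theorem wl_le {S : Set Γ} (w : List Γ) (hw : ∀ x ∈ w, x ∈ S) : wl S w.prod ≤ w.length :=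
  Nat.sInf_le ⟨w, rfl, hw, rfl⟩

theorem wl_mul {S : Set Γ} (hS : IsGenSet S) (x y : Γ) : wl S (x * y) ≤ wl S x + wl S y := by
  obtain ⟨w, hw, hw', rfl⟩ := wl_word hS x
  obtain ⟨v, hv, hv', rfl⟩ := wl_word hS y
  rw [← hw, ← hv, ← List.length_append, ← List.prod_append]
  apply wl_le
  intro z hz
  rcases List.mem_append.1 hz with h | h
  · exact hw' z h
  · exact hv' z h

theorem wl_inv_le {S : Set Γ} (hS : IsGenSet S) (x : Γ) : wl S x⁻¹ ≤ wl S x := by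
  obtain ⟨w, hw, hw', rfl⟩ := wl_word hS x
  rw [List.prod_inv_reverse, ← hw]
  refine (wl_le _ ?_).trans (by simp)
  intro z hz
  simp only [List.mem_reverse, List.mem_map] at hz
  obtain ⟨y, hy, rfl⟩ := hz
  exact hS.2.1 y (hw' y hy)

theorem wl_inv {S : Set Γ} (hS : IsGenSet S) (x : Γ) : wl S x⁻¹ = wl S x :=
  le_antisymm (wl_inv_le hS x) (by simpa using wl_inv_le hS x⁻¹)

theorem wl_one (S : Set Γ) : wl S (1 : Γ) = 0 := by
  have := wl_le (S := S) ([] : List Γ) (by simp)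
  simpa using this

theorem wl_geod {S : Set Γ} (hS : IsGenSet S) (g : Γ) (t : ℕ) (ht : t ≤ wl S g) :
    ∃ x : Γ, wl S x = t ∧ wl S (x⁻¹ * g) = wl S g - t := by
  obtain ⟨w, hw, hw', hp⟩ := wl_word hS g
  refine ⟨(w.take t).prod, ?_⟩
  have h1 : wl S (w.take t).prod ≤ t :=
    (wl_le _ fun x hx => hw' x (List.mem_of_mem_take hx)).trans (by simp)
  have h2 : wl S (w.drop t).prod ≤ wl S g - t :=
    (wl_le _ fun x hx => hw' x (List.mem_of_mem_drop hx)).trans (by simp [hw])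
  have e : (w.take t).prod * (w.drop t).prod = g := by
    rw [← List.prod_append, List.take_append_drop, hp]
  have e2 : (w.take t).prod⁻¹ * g = (w.drop t).prod := by rw [← e]; group
  rw [e2]
  have h3 := wl_mul hS (w.take t).prod (w.drop t).prod
  rw [e] at h3
  omega

theorem ball_finite {S : Set Γ} (hS : IsGenSet S) (n : ℕ) : {g : Γ | wl S g ≤ n}.Finite := by
  induction n with
  | zero =>
    refine (Set.finite_singleton (1 : Γ)).subset ?_
    intro g hg
    obtain ⟨w, hw, hw', rfl⟩ := wl_word hS g
    have : w.length = 0 := by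
      have : wl S w.prod ≤ 0 := hg
      omega
    rw [List.length_eq_zero_iff] at this
    simp [this]
  | succ n ih =>
    refine ((ih.mul hS.1).union ih).subset ?_
    intro g hg
    have hg' : wl S g ≤ n + 1 := hg
    by_cases h : wl S g ≤ n
    · exact Or.inr h
    left
    obtain ⟨x, hx, hx'⟩ := wl_geod hS g n (by omega)
    obtain ⟨w, hw, hw', hp⟩ := wl_word hS (x⁻¹ * g)
    have : w.length = 1 := by omega
    obtain ⟨s, rfl⟩ := List.length_eq_one_iff.1 this
    refine Set.mem_mul.2 ⟨x, show wl S x ≤ n by omega, s, by simpa using hw', ?_⟩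
    simp at hp
    rw [hp]; group

theorem wd_symm {S : Set Γ} (hS : IsGenSet S) (x y : Γ) : wdist S x y = wdist S y x := by
  unfold wdist
  rw [← wl_inv hS]; congr 1; group

theorem wd_tri {S : Set Γ} (hS : IsGenSet S) (x y z : Γ) :
    (wdist S x z : ℝ) ≤ wdist S x y + wdist S y z := by
  have := wl_mul hS (x⁻¹ * y) (y⁻¹ * z)
  have e : x⁻¹ * y * (y⁻¹ * z) = x⁻¹ * z := by group
  rw [e] at this
  unfold wdist
  exact_mod_cast this

theorem wd_inv (S : Set Γ) (g x y : Γ) : wdist S (g * x) (g * y) = wdist S x y := by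
  unfold wdist; congr 1; group

theorem wd_one {S : Set Γ} (hS : IsGenSet S) (x : Γ) : wdist S x 1 = wl S x := by
  rw [wd_symm hS]; simp [wdist]

theorem gp_trans (S : Set Γ) (g z x y : Γ) : gp S (g * z) (g * x) (g * y) = gp S z x y := by
  simp [gp, wd_inv]

theorem gp_nonneg {S : Set Γ} (hS : IsGenSet S) (z x y : Γ) : 0 ≤ gp S z x y := by
  have := wd_tri hS x z y
  rw [wd_symm hS z y] at this
  unfold gp; linarith

theorem gp_symm {S : Set Γ} (hS : IsGenSet S) (z x y : Γ) : gp S z x y = gp S z y x := by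
  unfold gp; rw [wd_symm hS x y]; ring

theorem gp_hyp {S : Set Γ} {δ : ℝ} (hδ : IsHyperbolic S δ) (p x y z : Γ) :
    min (gp S p x z) (gp S p y z) - δ ≤ gp S p x y := by
  have := hδ.2 (p⁻¹ * x) (p⁻¹ * y) (p⁻¹ * z)
  have e : ∀ u v : Γ, gp S 1 (p⁻¹ * u) (p⁻¹ * v) = gp S p u v := fun u v => by
    rw [← gp_trans S p]; simp
  rwa [e, e, e] at this

/-- Four point condition. -/
theorem four {S : Set Γ} {δ : ℝ} (hδ : IsHyperbolic S δ) (a b c e : Γ) :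
    (wdist S a b : ℝ) + wdist S c e ≤
      max ((wdist S a c : ℝ) + wdist S b e) ((wdist S a e : ℝ) + wdist S b c) + 2 * δ := by
  have h := gp_hyp hδ e a b c
  unfold gp at h
  rcases le_total ((wdist S a c : ℝ) + wdist S b e) ((wdist S a e : ℝ) + wdist S b c) with h1 | h1
  · rw [max_eq_right h1]
    rcases min_le_iff.1 (le_refl (min (((wdist S a e : ℝ) + (wdist S c e : ℝ) - (wdist S a c : ℝ)) / 2)
      (((wdist S b e : ℝ) + (wdist S c e : ℝ) - (wdist S b c : ℝ)) / 2))) with h2 | h2 <;> linarith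
  · rw [max_eq_left h1]
    rcases min_le_iff.1 (le_refl (min (((wdist S a e : ℝ) + (wdist S c e : ℝ) - (wdist S a c : ℝ)) / 2)
      (((wdist S b e : ℝ) + (wdist S c e : ℝ) - (wdist S b c : ℝ)) / 2))) with h2 | h2 <;> linarith

/-- Three-step hyperbolicity. -/
theorem gp_hyp3 {S : Set Γ} (hS : IsGenSet S) {δ : ℝ} (hδ : IsHyperbolic S δ) (p x y z w : Γ)
    (a : ℝ) (h1 : a ≤ gp S p x y) (h2 : a ≤ gp S p y z) (h3 : a ≤ gp S p z w) :
    a - 2 * δ ≤ gp S p x w := by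
  have h := gp_hyp hδ p x w z
  have h' := gp_hyp hδ p x z y
  have h0 := hδ.1
  rw [gp_symm hS p w z] at h
  rw [gp_symm hS p z y] at h'
  have e1 := le_min h1 h2
  have e2 : a - δ ≤ min (gp S p x z) (gp S p z w) := le_min (by linarith) (by linarith)
  linarith

/-- An element with `|h²| ≥ |h| + 2δ + 1` has linear growth. -/
theorem growth {S : Set Γ} (hS : IsGenSet S) {δ : ℝ} (hδ : IsHyperbolic S δ) (h : Γ)
    (hh : (wl S h : ℝ) + 2 * δ + 1 ≤ wl S (h ^ 2)) (n : ℕ) :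
    (wl S (h ^ n) : ℝ) + 1 ≤ wl S (h ^ (n + 1)) := by
  have h0 := hδ.1
  induction n with
  | zero =>
    have : (wl S (h ^ 2) : ℝ) ≤ wl S h + wl S h := by
      rw [pow_two]; exact_mod_cast wl_mul hS h h
    simp only [pow_zero, wl_one, zero_add, pow_one, Nat.cast_zero]; linarith
  | succ n ih =>
    have h4 := four hδ 1 (h ^ (n + 1)) (h ^ n) (h ^ (n + 2))
    have e1 : wdist S (h ^ n) (h ^ (n + 2)) = wl S (h ^ 2) := by
      unfold wdist; congr 1; rw [pow_add]; group
    have e2 : wdist S (h ^ (n + 1)) (h ^ (n + 2)) = wl S h := by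
      unfold wdist; congr 1; rw [pow_succ _ (n + 1)]; group
    have e3 : wdist S (h ^ (n + 1)) (h ^ n) = wl S h := by
      rw [wd_symm hS]
      unfold wdist; congr 1; rw [pow_succ]; group
    have e4 : ∀ x : Γ, wdist S 1 x = wl S x := fun x => by simp [wdist]
    rw [e1, e2, e3, e4, e4, e4] at h4
    rcases le_max_iff.1 (le_refl (max ((wl S (h ^ n) : ℝ) + wl S h)
      ((wl S (h ^ (n + 2)) : ℝ) + wl S h))) with h5 | h5
    · linarith
    · have : n + 1 + 1 = n + 2 := rfl
      rw [this]; linarith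

theorem wl_pow_unbounded {S : Set Γ} (hS : IsGenSet S) (g : Γ) (hg : ¬ IsOfFinOrder g) (L : ℕ) :
    ∃ m : ℕ, L ≤ wl S (g ^ m) := by
  by_contra hcon
  push Not at hcon
  have hinj : Function.Injective (fun n : ℕ => g ^ n) :=
    injective_pow_iff_not_isOfFinOrder.2 hg
  refine Set.infinite_range_of_injective hinj ((ball_finite hS L).subset ?_)
  rintro _ ⟨n, rfl⟩
  exact (hcon n).le

/-- Some conjugate of a power has `|h²| ≥ |h| + 2δ + 1`. -/
theorem exists_lox {S : Set Γ} (hS : IsGenSet S) {δ : ℝ} (hδ : IsHyperbolic S δ) (g : Γ)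
    (hg : ¬ IsOfFinOrder g) :
    ∃ (k : ℕ) (x : Γ), 0 < k ∧
      (wl S (x⁻¹ * g ^ k * x) : ℝ) + 2 * δ + 1 ≤ wl S ((x⁻¹ * g ^ k * x) ^ 2) := by
  by_contra hcon
  push Not at hcon
  have h0 := hδ.1
  obtain ⟨M, hM⟩ := exists_nat_ge (2 * (14 * δ + 1))
  set Bl := (ball_finite hS M).toFinset with hBl
  set N := Bl.card with hN
  obtain ⟨R, hR⟩ : ∃ R : ℕ, ∀ k ∈ Finset.range (2 * N + 3), wl S (g ^ k) ≤ R :=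
    ⟨(Finset.range (2 * N + 3)).sup (fun k => wl S (g ^ k)),
      fun k hk => Finset.le_sup (f := fun k => wl S (g ^ k)) hk⟩
  obtain ⟨t, ht⟩ := exists_nat_gt ((R : ℝ) + 2 * δ)
  obtain ⟨m, hm⟩ := wl_pow_unbounded hS g hg (2 * t)
  obtain ⟨x, hx, hx'⟩ := wl_geod hS (g ^ m) t (by omega)
  set y := g ^ m with hy
  set L := wl S y with hL
  -- near the geodesic
  have hLt : t ≤ L := by omega
  have hxL : (wl S (x⁻¹ * y) : ℝ) = L - t := by rw [hx']; push_cast [hLt]; ring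
  have hm' : (2 * t : ℝ) ≤ L := by exact_mod_cast hm
  have near : ∀ k ∈ Finset.range (2 * N + 3),
      (wdist S (g ^ k * x) 1 : ℝ) + wdist S (g ^ k * x) y ≤ L + 4 * δ := by
    intro k hk
    have hk' : (wl S (g ^ k) : ℝ) ≤ R := by exact_mod_cast hR k hk
    set p := g ^ k * x with hp
    have d1 : wdist S (g ^ k) p = t := by rw [hp]; simpa [wdist] using hx
    have d2 : (wdist S p (g ^ k * y) : ℝ) = L - t := by
      rw [hp, wd_inv]; exact hxL
    have d3 : wdist S (g ^ k) (g ^ k * y) = L := by simp [wdist, hL]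
    have d4 : wdist S 1 (g ^ k) = wl S (g ^ k) := by simp [wdist]
    have d5 : wdist S y (g ^ k * y) = wl S (g ^ k) := by
      unfold wdist; congr 1; rw [hy, ← pow_add, add_comm, pow_add]; group
    by_contra hc
    push Not at hc
    have dL : wdist S 1 y = L := by simp [wdist, hL]
    have a1 : (0:ℝ) ≤ wdist S 1 p := by positivity
    have t1 := wd_tri hS (g ^ k) 1 p
    have t2 := wd_tri hS p y (g ^ k * y)
    rw [wd_symm hS (g ^ k) 1] at t1
    rw [d4, d1] at t1
    rw [d5, d2] at t2
    rw [wd_symm hS p 1] at hc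
    have key := gp_hyp3 hS hδ p (g ^ k) 1 y (g ^ k * y)
      (min (gp S p (g ^ k) 1) (min (gp S p 1 y) (gp S p y (g ^ k * y))))
      (min_le_left _ _) ((min_le_right _ _).trans (min_le_left _ _))
      ((min_le_right _ _).trans (min_le_right _ _))
    have z : gp S p (g ^ k) (g ^ k * y) = 0 := by
      unfold gp
      rw [wd_symm hS (g ^ k * y) p, d1, d2, d3]; ring
    rw [z] at key
    have : 2 * δ < min (gp S p (g ^ k) 1) (min (gp S p 1 y) (gp S p y (g ^ k * y))) := by
      refine lt_min ?_ (lt_min ?_ ?_)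
      · unfold gp
        rw [wd_symm hS (g ^ k) 1, d4, d1]; linarith
      · unfold gp
        rw [wd_symm hS y p, dL]; linarith
      · unfold gp
        rw [wd_symm hS y p, wd_symm hS (g ^ k * y) p, d5, d2]; linarith
    linarith
  have close : ∀ k ∈ Finset.range (2 * N + 3), ∀ l ∈ Finset.range (2 * N + 3),
      (wdist S (g ^ k * x) (g ^ l * x) : ℝ) ≤
        |(wdist S (g ^ k * x) 1 : ℝ) - wdist S (g ^ l * x) 1| + 6 * δ := by
    intro k hk l hl
    have n1 := near k hk
    have n2 := near l hl
    have dL : wdist S 1 y = L := by simp [wdist, hL]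
    have f := four hδ (g ^ k * x) (g ^ l * x) 1 y
    rw [dL] at f
    have ab := le_abs_self ((wdist S (g ^ k * x) 1 : ℝ) - wdist S (g ^ l * x) 1)
    have ab' := neg_abs_le ((wdist S (g ^ k * x) 1 : ℝ) - wdist S (g ^ l * x) 1)
    rcases max_cases ((wdist S (g ^ k * x) 1 : ℝ) + wdist S (g ^ l * x) y)
      ((wdist S (g ^ k * x) y : ℝ) + wdist S (g ^ l * x) 1) with h | h <;> linarith
  have small : ∀ k ∈ Finset.range (N + 1), x⁻¹ * g ^ (2 * (k + 1)) * x ∈ Bl := by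
    intro k hk
    rw [Finset.mem_range] at hk
    rw [hBl, Set.Finite.mem_toFinset]
    show wl S _ ≤ M
    have c1 := close 0 (by simp) (k + 1) (by simp; omega)
    have c2 := close (k + 1) (by simp; omega) (2 * (k + 1)) (by simp; omega)
    have c3 := close 0 (by simp) (2 * (k + 1)) (by simp; omega)
    have hc := hcon (k + 1) x (by omega)
    set q := k + 1 with hq
    clear_value q
    have e1 : wdist S (g ^ 0 * x) (g ^ q * x) = wl S (x⁻¹ * g ^ q * x) := by
      unfold wdist; congr 1; group
    have e2 : wdist S (g ^ q * x) (g ^ (2 * q) * x) = wl S (x⁻¹ * g ^ q * x) := by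
      unfold wdist; congr 1; rw [two_mul, pow_add]; group
    have e3 : wdist S (g ^ 0 * x) (g ^ (2 * q) * x) = wl S (x⁻¹ * g ^ (2 * q) * x) := by
      unfold wdist; congr 1; group
    have e4 : (x⁻¹ * g ^ q * x) ^ 2 = x⁻¹ * g ^ (2 * q) * x := by
      rw [two_mul, pow_add, pow_two]; group
    have b3 : |(wdist S (g ^ 0 * x) 1 : ℝ) - wdist S (g ^ (2 * q) * x) 1| ≤
        wdist S (g ^ 0 * x) (g ^ (2 * q) * x) := by
      have u1 := wd_tri hS (g ^ 0 * x) (g ^ (2 * q) * x) 1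
      have u2 := wd_tri hS (g ^ (2 * q) * x) (g ^ 0 * x) 1
      rw [wd_symm hS (g ^ (2 * q) * x) (g ^ 0 * x)] at u2
      rw [abs_le]; constructor <;> linarith
    have b1 : |(wdist S (g ^ 0 * x) 1 : ℝ) - wdist S (g ^ q * x) 1| ≤
        wdist S (g ^ 0 * x) (g ^ q * x) := by
      have u1 := wd_tri hS (g ^ 0 * x) (g ^ q * x) 1
      have u2 := wd_tri hS (g ^ q * x) (g ^ 0 * x) 1
      rw [wd_symm hS (g ^ q * x) (g ^ 0 * x)] at u2
      rw [abs_le]; constructor <;> linarith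
    have b2 : |(wdist S (g ^ q * x) 1 : ℝ) - wdist S (g ^ (2 * q) * x) 1| ≤
        wdist S (g ^ q * x) (g ^ (2 * q) * x) := by
      have u1 := wd_tri hS (g ^ q * x) (g ^ (2 * q) * x) 1
      have u2 := wd_tri hS (g ^ (2 * q) * x) (g ^ q * x) 1
      rw [wd_symm hS (g ^ (2 * q) * x) (g ^ q * x)] at u2
      rw [abs_le]; constructor <;> linarith
    rw [e4] at hc
    rw [e1] at c1 b1
    rw [e2] at c2 b2
    rw [e3] at c3 b3
    have tr : (wl S (x⁻¹ * g ^ (2 * q) * x) : ℝ) ≤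
        wl S (x⁻¹ * g ^ q * x) + wl S (x⁻¹ * g ^ q * x) := by
      rw [← e4, pow_two]; exact_mod_cast wl_mul hS _ _
    have : (wl S (x⁻¹ * g ^ (2 * q) * x) : ℝ) ≤ M := by
      refine le_trans ?_ hM
      generalize (wl S (x⁻¹ * g ^ (2 * q) * x) : ℝ) = D2 at *
      generalize (wl S (x⁻¹ * g ^ q * x) : ℝ) = D1 at *
      generalize (wdist S (g ^ 0 * x) 1 : ℝ) = f0 at *
      generalize (wdist S (g ^ q * x) 1 : ℝ) = f1 at *
      generalize (wdist S (g ^ (2 * q) * x) 1 : ℝ) = f2 at *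
      by_cases hD : D1 ≤ 14 * δ + 1
      · linarith
      push Not at hD
      rcases abs_cases (f0 - f1) with ⟨h1, h1'⟩ | ⟨h1, h1'⟩ <;>
      rcases abs_cases (f1 - f2) with ⟨h2, h2'⟩ | ⟨h2, h2'⟩ <;>
      rcases abs_cases (f0 - f2) with ⟨h3, h3'⟩ | ⟨h3, h3'⟩ <;> linarith
    exact_mod_cast this
  obtain ⟨i, -, j, -, hij, he⟩ := Finset.exists_ne_map_eq_of_card_lt_of_maps_to
    (s := Finset.range (N + 1)) (t := Bl) (by simp [hN])
    (f := fun k => x⁻¹ * g ^ (2 * (k + 1)) * x) (fun k hk => small k hk)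
  have he' : g ^ (2 * (i + 1)) = g ^ (2 * (j + 1)) := by simpa using he
  have := injective_pow_iff_not_isOfFinOrder.2 hg he'
  omega

theorem gp_change {S : Set Γ} (hS : IsGenSet S) (z x y y' : Γ) :
    gp S z x y - wdist S y y' ≤ gp S z x y' := by
  have t1 := wd_tri hS y y' z
  have t2 := wd_tri hS x y y'
  unfold gp; linarith

theorem gp_change_base {S : Set Γ} (hS : IsGenSet S) (z z' x y : Γ) :
    gp S z x y - wdist S z z' ≤ gp S z' x y := by
  have t1 := wd_tri hS x z' z
  have t2 := wd_tri hS y z' z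
  rw [wd_symm hS z' z] at t1 t2
  unfold gp; linarith

theorem pow_gp {S : Set Γ} (hS : IsGenSet S) {δ : ℝ} (hδ : IsHyperbolic S δ) (g : Γ)
    (hg : ¬ IsOfFinOrder g) :
    ∃ a b : ℝ, 0 < a ∧ ∀ n m : ℕ, n ≤ m → a * n - b ≤ gp S 1 (g ^ n) (g ^ m) := by
  obtain ⟨k, x, hk, hh⟩ := exists_lox hS hδ g hg
  set h := x⁻¹ * g ^ k * x with hdef
  have gr := growth hS hδ h hh
  have gr2 : ∀ n m : ℕ, (wl S (h ^ n) : ℝ) + m ≤ wl S (h ^ (n + m)) := by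
    intro n m
    induction m with
    | zero => simp
    | succ m ih => have := gr (n + m); push_cast; rw [← add_assoc n m 1]; linarith
  have hgp : ∀ n m : ℕ, n ≤ m → (n : ℝ) ≤ gp S 1 (h ^ n) (h ^ m) := by
    intro n m hnm
    obtain ⟨l, rfl⟩ := Nat.exists_eq_add_of_le hnm
    have e : wdist S (h ^ n) (h ^ (n + l)) = wl S (h ^ l) := by
      unfold wdist; congr 1; rw [pow_add]; group
    unfold gp
    rw [wd_one hS, wd_one hS, e]
    have g1 := gr2 0 n
    have g2 := gr2 l n
    rw [add_comm l n] at g2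
    simp only [pow_zero, wl_one, zero_add, Nat.cast_zero] at g1
    linarith
  obtain ⟨M, hM⟩ : ∃ M : ℕ, ∀ r ∈ Finset.range k, wl S (x⁻¹ * g ^ r) ≤ M :=
    ⟨(Finset.range k).sup (fun r => wl S (x⁻¹ * g ^ r)),
      fun r hr => Finset.le_sup (f := fun r => wl S (x⁻¹ * g ^ r)) hr⟩
  have hkR : (0 : ℝ) < k := by exact_mod_cast hk
  have hpow : ∀ q : ℕ, x * h ^ q = g ^ (k * q) * x := by
    intro q
    induction q with
    | zero => simp
    | succ q ih => rw [pow_succ, ← mul_assoc, ih, hdef, mul_add, pow_add]; group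
  have hdist : ∀ n : ℕ, (wdist S (x * h ^ (n / k)) (g ^ n) : ℝ) ≤ M := by
    intro n
    have h1 := hM (n % k) (Finset.mem_range.2 (Nat.mod_lt _ hk))
    have : wdist S (x * h ^ (n / k)) (g ^ n) = wl S (x⁻¹ * g ^ (n % k)) := by
      unfold wdist; congr 1
      rw [hpow]
      conv_lhs => rw [← Nat.div_add_mod n k, pow_add]
      have : (k * (n / k) + n % k) / k = n / k := by rw [Nat.div_add_mod]
      rw [this]; group
    rw [this]; exact_mod_cast h1
  refine ⟨1 / k, 1 + wdist S x⁻¹ 1 + 2 * M, by positivity, ?_⟩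
  intro n m hnm
  have hq : n / k ≤ m / k := Nat.div_le_div_right hnm
  have s1 := hgp _ _ hq
  have s2 := gp_change_base hS 1 x⁻¹ (h ^ (n / k)) (h ^ (m / k))
  rw [← gp_trans S x x⁻¹, mul_inv_cancel, wd_symm hS] at s2
  have s3 := gp_change hS 1 (x * h ^ (n / k)) (x * h ^ (m / k)) (g ^ m)
  have s4 := gp_change hS 1 (g ^ m) (x * h ^ (n / k)) (g ^ n)
  rw [gp_symm hS 1 (g ^ m), gp_symm hS 1 (g ^ m)] at s4
  have d1 := hdist n
  have d2 := hdist m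
  have s5 : 1 / (k : ℝ) * n - 1 ≤ ((n / k : ℕ) : ℝ) := by
    have : (n : ℝ) ≤ k * ((n / k : ℕ) : ℝ) + k := by
      have := (Nat.lt_mul_div_succ n hk).le
      have h2 : n ≤ k * (n / k) + k := by rw [mul_add] at this; simpa using this
      exact_mod_cast h2
    rw [one_div, inv_mul_eq_div, sub_le_iff_le_add, div_le_iff₀ hkR]; linarith
  linarith

theorem ev_iff (P : ℕ → ℕ → Prop) :
    (∀ᶠ p : ℕ × ℕ in atTop, P p.1 p.2) ↔ ∃ N, ∀ i ≥ N, ∀ j ≥ N, P i j := by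
  rw [eventually_atTop]
  constructor
  · rintro ⟨⟨a, b⟩, h⟩
    exact ⟨max a b, fun i hi j hj => h (i, j)
      ⟨(le_max_left a b).trans hi, (le_max_right a b).trans hj⟩⟩
  · rintro ⟨N, h⟩
    exact ⟨(N, N), fun p hp => h p.1 hp.1 p.2 hp.2⟩

theorem equiv_iff {S : Set Γ} (u v : ℕ → Γ) :
    EquivSeq S u v ↔ ∀ a : ℝ, ∃ N, ∀ i ≥ N, ∀ j ≥ N, a ≤ gp S 1 (u i) (v j) := by
  unfold EquivSeq
  rw [tendsto_atTop]
  exact forall_congr' fun a => ev_iff (fun i j => a ≤ gp S 1 (u i) (v j))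

theorem convInf_iff {S : Set Γ} (u : ℕ → Γ) :
    ConvInf S u ↔ ∀ a : ℝ, ∃ N, ∀ i ≥ N, ∀ j ≥ N, a ≤ gp S 1 (u i) (u j) :=
  equiv_iff u u

theorem le_bgp {S : Set Γ} (B : Boundary Γ S) {ξ η : B.pt} {u v : ℕ → Γ}
    (hu : ConvInf S u ∧ B.cls u = ξ) (hv : ConvInf S v ∧ B.cls v = η) {a : ℝ} {N : ℕ}
    (h : ∀ i ≥ N, ∀ j ≥ N, a ≤ gp S 1 (u i) (v j)) : ENNReal.ofReal a ≤ bgp B ξ η := by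
  unfold bgp
  refine le_iSup_of_le ⟨u, hu⟩ (le_iSup_of_le ⟨v, hv⟩ ?_)
  refine le_liminf_of_le (by isBoundedDefault) ?_
  rw [ev_iff (fun i j => ENNReal.ofReal a ≤ ENNReal.ofReal (gp S 1 (u i) (v j)))]
  exact ⟨N, fun i hi j hj => ENNReal.ofReal_le_ofReal (h i hi j hj)⟩

theorem lt_bgp {S : Set Γ} (B : Boundary Γ S) {ξ η : B.pt} {a : ℝ}
    (ha : 0 ≤ a) (h : ENNReal.ofReal a < bgp B ξ η) :
    ∃ u v : ℕ → Γ, (ConvInf S u ∧ B.cls u = ξ) ∧ (ConvInf S v ∧ B.cls v = η) ∧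
      ∃ N, ∀ i ≥ N, ∀ j ≥ N, a ≤ gp S 1 (u i) (v j) := by
  unfold bgp at h
  obtain ⟨⟨u, hu⟩, h⟩ := lt_iSup_iff.1 h
  obtain ⟨⟨v, hv⟩, h⟩ := lt_iSup_iff.1 h
  refine ⟨u, v, hu, hv, ?_⟩
  have := eventually_lt_of_lt_liminf h
  obtain ⟨N, hN⟩ := (ev_iff
    (fun i j => ENNReal.ofReal a < ENNReal.ofReal (gp S 1 (u i) (v j)))).1 this
  exact ⟨N, fun i hi j hj => ((ENNReal.ofReal_lt_ofReal_iff_of_nonneg ha).1 (hN i hi j hj)).le⟩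

theorem bgp_le {S : Set Γ} (B : Boundary Γ S) {ξ η : B.pt} {u v : ℕ → Γ}
    (hu : ConvInf S u ∧ B.cls u = ξ) (hv : ConvInf S v ∧ B.cls v = η) {r : ℝ} (hr : 0 ≤ r)
    (h : bgp B ξ η ≤ ENNReal.ofReal r) (N : ℕ) :
    ∃ i ≥ N, ∃ j ≥ N, gp S 1 (u i) (v j) < r + 1 := by
  by_contra hc
  push Not at hc
  have h1 := (le_bgp B hu hv hc).trans h
  rw [ENNReal.ofReal_le_ofReal_iff hr] at h1
  linarith

theorem bgp_symm {S : Set Γ} (hS : IsGenSet S) (B : Boundary Γ S) (ξ η : B.pt) :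
    bgp B ξ η = bgp B η ξ := by
  have key : ∀ ξ η : B.pt, bgp B ξ η ≤ bgp B η ξ := by
    intro ξ η
    refine le_of_forall_lt fun a ha => ?_
    obtain ⟨b, hab, hb⟩ := exists_between ha
    have hbt : b ≠ ⊤ := (hb.trans_le le_top).ne
    rw [← ENNReal.ofReal_toReal hbt] at hb
    obtain ⟨u, v, hu, hv, N, hN⟩ := lt_bgp B ENNReal.toReal_nonneg hb
    have := le_bgp B hv hu (a := b.toReal) (N := N)
      (fun i hi j hj => by rw [gp_symm hS]; exact hN j hj i hi)
    rw [ENNReal.ofReal_toReal hbt] at this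
    exact hab.trans_le this
  exact le_antisymm (key _ _) (key _ _)

theorem equiv_of_cls {S : Set Γ} (B : Boundary Γ S) {ξ : B.pt} {u v : ℕ → Γ}
    (hu : ConvInf S u ∧ B.cls u = ξ) (hv : ConvInf S v ∧ B.cls v = ξ) (a : ℝ) :
    ∃ N, ∀ i ≥ N, ∀ j ≥ N, a ≤ gp S 1 (u i) (v j) :=
  (equiv_iff u v).1 ((B.cls_eq u v hu.1 hv.1).1 (hu.2.trans hv.2.symm)) a

/-- Quasi-ultrametric inequality on the boundary. -/
theorem bgp_ultra {S : Set Γ} (hS : IsGenSet S) {δ : ℝ} (hδ : IsHyperbolic S δ)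
    (B : Boundary Γ S) {ξ η ζ : B.pt} {a : ℝ} (ha : 0 ≤ a)
    (h1 : ENNReal.ofReal a < bgp B ξ ζ) (h2 : ENNReal.ofReal a < bgp B ζ η) :
    ENNReal.ofReal (a - 2 * δ) ≤ bgp B ξ η := by
  obtain ⟨u, w, hu, hw, N1, hN1⟩ := lt_bgp B ha h1
  obtain ⟨w', v, hw', hv, N2, hN2⟩ := lt_bgp B ha h2
  obtain ⟨N3, hN3⟩ := equiv_of_cls B hw hw' a
  set N := max N1 (max N2 N3)
  have e1 : N1 ≤ N := le_max_left _ _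
  have e2 : N2 ≤ N := (le_max_left _ _).trans (le_max_right _ _)
  have e3 : N3 ≤ N := (le_max_right _ _).trans (le_max_right _ _)
  refine le_bgp B hu hv (N := N) fun i hi j hj => ?_
  exact gp_hyp3 hS hδ 1 (u i) (w N) (w' N) (v j) a (hN1 i (e1.trans hi) N e1)
    (hN3 N e3 N e3) (hN2 N e2 j (e2.trans hj))

theorem bgp_self {S : Set Γ} (B : Boundary Γ S) (ξ : B.pt) : bgp B ξ ξ = ⊤ := by
  obtain ⟨u, hu⟩ := B.cls_surj ξ
  refine ENNReal.eq_top_of_forall_nnreal_le fun r => ?_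
  obtain ⟨N, hN⟩ := (convInf_iff u).1 hu.1 r
  have := le_bgp B hu hu hN
  simpa using this

theorem eq_of_bgp_top {S : Set Γ} (hS : IsGenSet S) {δ : ℝ} (hδ : IsHyperbolic S δ)
    (B : Boundary Γ S) {ξ η : B.pt} (h : bgp B ξ η = ⊤) : ξ = η := by
  obtain ⟨u, hu⟩ := B.cls_surj ξ
  obtain ⟨v, hv⟩ := B.cls_surj η
  rw [← hu.2, ← hv.2, B.cls_eq u v hu.1 hv.1, equiv_iff]
  intro a
  have h0 := hδ.1
  obtain ⟨u', v', hu', hv', N1, hN1⟩ := lt_bgp B (a := |a| + 2 * δ) (by positivity)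
    (by rw [h]; exact ENNReal.ofReal_lt_top)
  obtain ⟨N2, hN2⟩ := equiv_of_cls B hu hu' (|a| + 2 * δ)
  obtain ⟨N3, hN3⟩ := equiv_of_cls B hv' hv (|a| + 2 * δ)
  set N := max N1 (max N2 N3)
  have e1 : N1 ≤ N := le_max_left _ _
  have e2 : N2 ≤ N := (le_max_left _ _).trans (le_max_right _ _)
  have e3 : N3 ≤ N := (le_max_right _ _).trans (le_max_right _ _)
  refine ⟨N, fun i hi j hj => ?_⟩
  have := gp_hyp3 hS hδ 1 (u i) (u' N) (v' N) (v j) _ (hN2 i (e2.trans hi) N e2)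
    (hN1 N e1 N e1) (hN3 N e3 j (e3.trans hj))
  linarith [le_abs_self a]

/-- Compact sets avoiding `ζ` avoid some `V_r(ζ)`. -/
theorem compact_bdd {S : Set Γ} (hS : IsGenSet S) {δ : ℝ} (hδ : IsHyperbolic S δ)
    (B : Boundary Γ S) (ζ : B.pt) (K : Set B.pt) (hK : @IsCompact B.pt (btop B) K)
    (hζ : ∀ ξ ∈ K, ξ ≠ ζ) :
    ∃ r : ℝ, 0 < r ∧ ∀ ξ ∈ K, bgp B ξ ζ ≤ ENNReal.ofReal r := by
  have h0 := hδ.1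
  let _ := btop B
  let O : ℕ → Set B.pt := fun n =>
    {q | ∃ r : ℝ≥0∞, r ≠ ⊤ ∧ {p | r < bgp B p q} ⊆ {p | bgp B p ζ ≤ (n : ℝ≥0∞)}}
  have hsub : ∀ n, O n ⊆ {p | bgp B p ζ ≤ (n : ℝ≥0∞)} := by
    rintro n q ⟨r, hr, h⟩
    exact h (show r < bgp B q q by rw [bgp_self]; exact hr.lt_top)
  have hopen : ∀ n, IsOpen (O n) := by
    intro n
    show ∀ q ∈ O n, ∃ r : ℝ≥0∞, r ≠ ⊤ ∧ {p | r < bgp B p q} ⊆ O n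
    rintro q ⟨r, hr, h⟩
    refine ⟨ENNReal.ofReal (r.toReal + 1 + 2 * δ), ENNReal.ofReal_ne_top, fun q' hq' => ?_⟩
    refine ⟨ENNReal.ofReal (r.toReal + 1 + 2 * δ), ENNReal.ofReal_ne_top, fun p hp => h ?_⟩
    have := bgp_ultra hS hδ B (by positivity) hp hq'
    refine lt_of_lt_of_le ?_ this
    conv_lhs => rw [← ENNReal.ofReal_toReal hr]
    refine (ENNReal.ofReal_lt_ofReal_iff_of_nonneg ENNReal.toReal_nonneg).2 (by linarith)
  have hcov : K ⊆ ⋃ n, O n := by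
    intro p hp
    have hf : bgp B p ζ ≠ ⊤ := fun h => hζ p hp (eq_of_bgp_top hS hδ B h)
    obtain ⟨n, hn⟩ := exists_nat_ge ((bgp B p ζ).toReal + 1 + 2 * δ)
    refine Set.mem_iUnion.2 ⟨n, ENNReal.ofReal ((bgp B p ζ).toReal + 1 + 2 * δ),
      ENNReal.ofReal_ne_top, fun q hq => ?_⟩
    show bgp B q ζ ≤ n
    by_contra hc
    push Not at hc
    have hq' : ENNReal.ofReal ((bgp B p ζ).toReal + 1 + 2 * δ) < bgp B p q := by
      rw [bgp_symm hS B p q]; exact hq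
    have h2 : ENNReal.ofReal ((bgp B p ζ).toReal + 1 + 2 * δ) < bgp B q ζ := by
      refine lt_of_le_of_lt ?_ hc
      rw [← ENNReal.ofReal_natCast]
      exact ENNReal.ofReal_le_ofReal hn
    have := bgp_ultra hS hδ B (by positivity) hq' h2
    conv_rhs at this => rw [← ENNReal.ofReal_toReal hf]
    rw [ENNReal.ofReal_le_ofReal_iff ENNReal.toReal_nonneg] at this
    linarith
  have hmono : ∀ i j : ℕ, i ≤ j → O i ⊆ O j := by
    rintro i j hij q ⟨r, hr, h⟩
    exact ⟨r, hr, fun p hp =>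
      le_trans (show bgp B p ζ ≤ (i : ℝ≥0∞) from h hp) (by exact_mod_cast hij)⟩
  obtain ⟨n, hn⟩ := hK.elim_directed_cover O hopen hcov
    (fun i j => ⟨max i j, hmono _ _ (le_max_left i j), hmono _ _ (le_max_right i j)⟩)
  refine ⟨n + 1, by positivity, fun ξ hξ => (hsub n (hn hξ)).trans ?_⟩
  rw [← ENNReal.ofReal_natCast]
  exact ENNReal.ofReal_le_ofReal (by linarith)

theorem gp_mul_eq {S : Set Γ} (hS : IsGenSet S) (p x y : Γ) :
    gp S 1 (p⁻¹ * x) (p⁻¹ * y) = gp S 1 x y + wl S p - gp S 1 x p - gp S 1 y p := by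
  have e : gp S 1 (p⁻¹ * x) (p⁻¹ * y) = gp S p x y := by
    rw [← gp_trans S p]; simp
  rw [e]
  unfold gp
  rw [wd_one hS p]; ring

theorem gp_le {S : Set Γ} (hS : IsGenSet S) (x p : Γ) : gp S 1 x p ≤ wl S p := by
  have := wd_tri hS x p 1
  unfold gp
  rw [wd_one hS p] at *; linarith

theorem convInf_mul {S : Set Γ} (hS : IsGenSet S) (p : Γ) (u : ℕ → Γ) (hu : ConvInf S u) :
    ConvInf S fun n => p * u n := by
  rw [convInf_iff] at *
  intro a
  obtain ⟨N, hN⟩ := hu (a + wl S p⁻¹)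
  refine ⟨N, fun i hi j hj => ?_⟩
  have h1 := gp_mul_eq hS p⁻¹ (u i) (u j)
  rw [inv_inv] at h1
  have h2 := hN i hi j hj
  have h3 := gp_le hS (u i) p⁻¹
  have h4 := gp_le hS (u j) p⁻¹
  show a ≤ gp S 1 (p * u i) (p * u j)
  linarith

theorem rep_mul {S : Set Γ} (hS : IsGenSet S) (B : Boundary Γ S) {ξ : B.pt} (p : Γ) {u : ℕ → Γ}
    (hu : ConvInf S u ∧ B.cls u = ξ) :
    ConvInf S (fun n => p * u n) ∧ B.cls (fun n => p * u n) = B.smul p ξ :=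
  ⟨convInf_mul hS p u hu.1, by rw [← hu.2, B.smul_cls p u hu.1]⟩

theorem convInf_pow {S : Set Γ} (hS : IsGenSet S) {δ : ℝ} (hδ : IsHyperbolic S δ) (g : Γ)
    (hg : ¬ IsOfFinOrder g) : ConvInf S fun n => g ^ n := by
  obtain ⟨a, b, ha, h⟩ := pow_gp hS hδ g hg
  rw [convInf_iff]
  intro M
  obtain ⟨N, hN⟩ := exists_nat_ge ((M + b) / a)
  rw [div_le_iff₀ ha] at hN
  have key : ∀ i ≥ N, ∀ j, i ≤ j → M ≤ gp S 1 (g ^ i) (g ^ j) := by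
    intro i hi j hij
    have h1 := h i j hij
    have : (N : ℝ) ≤ i := by exact_mod_cast hi
    nlinarith
  refine ⟨N, fun i hi j hj => ?_⟩
  rcases le_total i j with hij | hij
  · exact key i hi j hij
  · rw [gp_symm hS]; exact key j hj i hij

/-- Uniform bound on `(u_i | g⁻ᵏ)`. -/
theorem gp_bdd {S : Set Γ} (hS : IsGenSet S) {δ : ℝ} (hδ : IsHyperbolic S δ)
    (B : Boundary Γ S) (g : Γ) (hg : ¬ IsOfFinOrder g) (r : ℝ) (hr : 0 ≤ r) :
    ∃ C : ℝ, 0 ≤ C ∧ ∀ ξ : B.pt, bgp B ξ (minusPt B g) ≤ ENNReal.ofReal r →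
      ∀ u : ℕ → Γ, (ConvInf S u ∧ B.cls u = ξ) →
      ∃ N, ∀ i ≥ N, ∀ k : ℕ, gp S 1 (u i) (g⁻¹ ^ k) ≤ C := by
  have h0 := hδ.1
  have hg' : ¬ IsOfFinOrder g⁻¹ := by rwa [isOfFinOrder_inv_iff]
  have hc := convInf_pow hS hδ g⁻¹ hg'
  obtain ⟨K, hK⟩ := (convInf_iff _).1 hc (r + 1 + 2 * δ)
  obtain ⟨R, hR⟩ : ∃ R : ℕ, ∀ k ∈ Finset.range K, wl S (g⁻¹ ^ k) ≤ R :=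
    ⟨(Finset.range K).sup (fun k => wl S (g⁻¹ ^ k)),
      fun k hk => Finset.le_sup (f := fun k => wl S (g⁻¹ ^ k)) hk⟩
  refine ⟨max R (r + 1 + 2 * δ), le_max_of_le_left (by positivity), ?_⟩
  intro ξ hξ u hu
  obtain ⟨N, hN⟩ := (convInf_iff _).1 hu.1 (r + 1 + 2 * δ)
  refine ⟨N, fun i hi k => ?_⟩
  by_cases hk : k < K
  · refine le_max_of_le_left ((gp_le hS _ _).trans ?_)
    exact_mod_cast hR k (Finset.mem_range.2 hk)
  push Not at hk
  refine le_max_of_le_right ?_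
  by_contra hcon
  push Not at hcon
  obtain ⟨i', hi', m, hm, hlt⟩ := bgp_le B hu ⟨hc, rfl⟩ hr hξ (max N K)
  have := gp_hyp3 hS hδ 1 (u i') (u i) (g⁻¹ ^ k) (g⁻¹ ^ m) (r + 1 + 2 * δ)
    (hN i' ((le_max_left _ _).trans hi') i hi) hcon.le
    (hK k hk m ((le_max_right _ _).trans hm))
  linarith

/-- Main expansion estimates. -/
theorem expand {S : Set Γ} (hS : IsGenSet S) {δ : ℝ} (hδ : IsHyperbolic S δ)
    (B : Boundary Γ S) (g : Γ) (hg : ¬ IsOfFinOrder g) :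
    ∃ a : ℝ, 0 < a ∧ ∀ r : ℝ, 0 ≤ r → ∃ C : ℝ,
      (∀ ξ : B.pt, bgp B ξ (minusPt B g) ≤ ENNReal.ofReal r → ∀ k : ℕ,
        ENNReal.ofReal (a * k - C) ≤ bgp B (B.smul (g ^ k) ξ) (plusPt B g)) ∧
      (∀ ξ η : B.pt, bgp B ξ (minusPt B g) ≤ ENNReal.ofReal r →
        bgp B η (minusPt B g) ≤ ENNReal.ofReal r → bgp B ξ η ≠ ⊤ → ∀ k : ℕ,
        ENNReal.ofReal (bgpR B ξ η + a * k - C) ≤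
          bgp B (B.smul (g ^ k) ξ) (B.smul (g ^ k) η)) := by
  have h0 := hδ.1
  obtain ⟨a, b, ha, hab⟩ := pow_gp hS hδ g hg
  have hlen : ∀ k : ℕ, a * k - b ≤ wl S (g ^ k) := fun k =>
    (hab k k le_rfl).trans (gp_le hS _ _)
  have hinv : ∀ k : ℕ, wl S (g⁻¹ ^ k) = wl S (g ^ k) := fun k => by rw [inv_pow, wl_inv hS]
  refine ⟨a, ha, fun r hr => ?_⟩
  obtain ⟨C, hC0, hC⟩ := gp_bdd hS hδ B g hg r hr
  refine ⟨b + 2 * C + δ + 1, ?_, ?_⟩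
  · intro ξ hξ k
    obtain ⟨u, hu⟩ := B.cls_surj ξ
    obtain ⟨N, hN⟩ := hC ξ hξ u hu
    refine le_bgp B (rep_mul hS B (g ^ k) hu) ⟨convInf_pow hS hδ g hg, rfl⟩ (N := max N k) ?_
    intro i hi j hj
    have h1 := hN i ((le_max_left _ _).trans hi) k
    have h2 := hab k j ((le_max_right _ _).trans hj)
    have h3 := gp_mul_eq hS (g⁻¹ ^ k) (u i) 1
    have e : (g⁻¹ ^ k)⁻¹ = g ^ k := by simp
    have e1 : gp S 1 (u i) 1 = 0 := le_antisymm (by simpa [wl_one] using gp_le hS (u i) 1)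
      (gp_nonneg hS _ _ _)
    have e2 : gp S 1 1 (g⁻¹ ^ k) = 0 := by
      rw [gp_symm hS]
      exact le_antisymm (by simpa [wl_one] using gp_le hS (g⁻¹ ^ k) 1) (gp_nonneg hS _ _ _)
    rw [e, e1, e2, hinv, mul_one] at h3
    have h4 := gp_hyp hδ 1 (g ^ k * u i) (g ^ j) (g ^ k)
    rw [gp_symm hS 1 (g ^ j)] at h4
    have h5 := hlen k
    have : a * k - b - C ≤ min (gp S 1 (g ^ k * u i) (g ^ k)) (gp S 1 (g ^ k) (g ^ j)) :=
      le_min (by linarith) (by linarith)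
    show _ ≤ gp S 1 (g ^ k * u i) (g ^ j)
    linarith
  · intro ξ η hξ hη hfin k
    have hrep : ∃ u v : ℕ → Γ, (ConvInf S u ∧ B.cls u = ξ) ∧ (ConvInf S v ∧ B.cls v = η) ∧
        ∃ N, ∀ i ≥ N, ∀ j ≥ N, bgpR B ξ η - 1 ≤ gp S 1 (u i) (v j) := by
      by_cases h1 : 0 ≤ bgpR B ξ η - 1
      · refine lt_bgp B h1 ?_
        conv_rhs => rw [← ENNReal.ofReal_toReal hfin]
        rw [ENNReal.ofReal_lt_ofReal_iff_of_nonneg h1]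
        exact sub_one_lt _
      · push Not at h1
        obtain ⟨u, hu⟩ := B.cls_surj ξ
        obtain ⟨v, hv⟩ := B.cls_surj η
        exact ⟨u, v, hu, hv, 0, fun i _ j _ => h1.le.trans (gp_nonneg hS _ _ _)⟩
    obtain ⟨u, v, hu, hv, N, hN⟩ := hrep
    obtain ⟨N1, hN1⟩ := hC ξ hξ u hu
    obtain ⟨N2, hN2⟩ := hC η hη v hv
    refine le_bgp B (rep_mul hS B (g ^ k) hu) (rep_mul hS B (g ^ k) hv)
      (N := max N (max N1 N2)) ?_
    intro i hi j hj
    have f1 := hN i ((le_max_left _ _).trans hi) j ((le_max_left _ _).trans hj)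
    have f2 := hN1 i (((le_max_left _ _).trans (le_max_right _ _)).trans hi) k
    have f3 := hN2 j (((le_max_right _ _).trans (le_max_right _ _)).trans hj) k
    have h3 := gp_mul_eq hS (g⁻¹ ^ k) (u i) (v j)
    have e : (g⁻¹ ^ k)⁻¹ = g ^ k := by simp
    rw [e, hinv] at h3
    have h5 := hlen k
    show _ ≤ gp S 1 (g ^ k * u i) (g ^ k * v j)
    linarith

/-- Hölder bound in terms of a lower bound for the Gromov product. -/
theorem holder_bound {S : Set Γ} (hS : IsGenSet S) {δ : ℝ} (hδ : IsHyperbolic S δ)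
    (B : Boundary Γ S) {G : Type} [MetricSpace G] (τ : ℝ) (hτ0 : 0 < τ) (hτ1 : τ < 1)
    (f : B.pt → G) (A : ℝ) (hA : 0 < A)
    (hf : ∀ ξ η : B.pt, dist (f ξ) (f η) ≤ A * τ ^ (bgpR B ξ η))
    (ξ η : B.pt) (s : ℝ) (h : ENNReal.ofReal s ≤ bgp B ξ η) :
    dist (f ξ) (f η) ≤ A * τ ^ s := by
  by_cases ht : bgp B ξ η = ⊤
  · rw [eq_of_bgp_top hS hδ B ht, dist_self]; positivity
  · refine (hf ξ η).trans ?_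
    refine mul_le_mul_of_nonneg_left ?_ hA.le
    refine Real.rpow_le_rpow_of_exponent_ge hτ0 hτ1.le ?_
    unfold bgpR
    exact (ENNReal.ofReal_le_iff_le_toReal ht).1 h

end Helpers

theorem cocycle_limit_exists
    (Γ : Type) [Group Γ] (S : Set Γ) (δ : ℝ)
    (hS : IsGenSet S) (hδ : IsHyperbolic S δ) (hne : Nonelementary Γ)
    (B : Boundary Γ S)
    (G : Type) [Group G] [MetricSpace G] [CompleteSpace G]
    (hinvL : ∀ a x y : G, dist (a * x) (a * y) = dist x y)
    (hinvR : ∀ a x y : G, dist (x * a) (y * a) = dist x y)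
    (τ : ℝ) (hτ0 : 0 < τ) (hτ1 : τ < 1)
    (c : Γ → B.pt → G)
    (A : Γ → ℝ) (hA : ∀ g : Γ, 0 < A g)
    (hHolder : ∀ (g : Γ) (ξ η : B.pt), dist (c g ξ) (c g η) ≤ A g * τ ^ (bgpR B ξ η))
    (hcocycle : ∀ (g h : Γ) (ω : B.pt), c (g * h) ω = c g ω * c h (B.smul g⁻¹ ω))
    (hfix : ∀ g : Γ, ¬ IsOfFinOrder g → c g (plusPt B g) = 1 ∧ c g (minusPt B g) = 1)
    (g : Γ) (hg : ¬ IsOfFinOrder g) :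
    ∃ bg : B.pt → G,
      (∀ ξ : B.pt, ξ ≠ minusPt B g →
        Tendsto (fun n : ℕ => c (g⁻¹ ^ n) ξ) atTop (𝓝 (bg ξ))) ∧
      (∀ K : Set B.pt, @IsCompact B.pt (btop B) K → (∀ ξ ∈ K, ξ ≠ minusPt B g) →
        TendstoUniformlyOn (fun (n : ℕ) (ξ : B.pt) => c (g⁻¹ ^ n) ξ) bg atTop K) ∧
      ∀ r : ℝ, 0 < r → ∃ C' : ℝ, 0 < C' ∧ ∀ ξ η : B.pt,
        bgp B ξ (minusPt B g) ≤ ENNReal.ofReal r →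
        bgp B η (minusPt B g) ≤ ENNReal.ofReal r →
        dist (bg ξ) (bg η) ≤ C' * τ ^ (bgpR B ξ η) := by
  obtain ⟨a, ha, hexp⟩ := expand hS hδ B g hg
  have hg' : ¬ IsOfFinOrder g⁻¹ := by rwa [isOfFinOrder_inv_iff]
  set q := τ ^ a with hq
  have hq0 : 0 < q := Real.rpow_pos_of_pos hτ0 a
  have hq1 : q < 1 := Real.rpow_lt_one hτ0.le hτ1 ha
  have hc1 : ∀ ω, c 1 ω = 1 := by
    intro ω
    have hω : ∀ ω, B.smul 1 ω = ω := by
      intro ω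
      obtain ⟨u, hu⟩ := B.cls_surj ω
      rw [← hu.2, B.smul_cls 1 u hu.1]; simp
    have := hcocycle 1 1 ω
    rw [mul_one, inv_one, hω] at this
    exact (mul_eq_left.1 this.symm)
  have hstep : ∀ (n : ℕ) (ξ : B.pt),
      c (g⁻¹ ^ (n + 1)) ξ = c (g⁻¹ ^ n) ξ * c g⁻¹ (B.smul (g ^ n) ξ) := by
    intro n ξ
    rw [pow_succ, hcocycle]; simp
  have hplus : c g⁻¹ (plusPt B g) = 1 := by
    have := (hfix g⁻¹ hg').2
    unfold minusPt at this
    rw [inv_inv] at this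
    exact this
  have hpw : ∀ (s C : ℝ) (k : ℕ), τ ^ (s + a * k - C) = τ ^ (-C) * q ^ k * τ ^ s := by
    intro s C k
    rw [hq, ← Real.rpow_natCast, ← Real.rpow_mul hτ0.le, ← Real.rpow_add hτ0,
      ← Real.rpow_add hτ0]
    congr 1; ring
  -- geometric estimate for consecutive terms
  have hgeo : ∀ r : ℝ, 0 ≤ r → ∃ C : ℝ, ∀ ξ : B.pt,
      bgp B ξ (minusPt B g) ≤ ENNReal.ofReal r →
      ∀ n : ℕ, dist (c (g⁻¹ ^ n) ξ) (c (g⁻¹ ^ (n + 1)) ξ) ≤ C * q ^ n := by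
    intro r hr
    obtain ⟨C, hC, -⟩ := hexp r hr
    refine ⟨A g⁻¹ * τ ^ (-C), fun ξ hξ n => ?_⟩
    have e : dist (c (g⁻¹ ^ n) ξ) (c (g⁻¹ ^ (n + 1)) ξ) =
        dist (c g⁻¹ (B.smul (g ^ n) ξ)) (c g⁻¹ (plusPt B g)) := by
      rw [hstep, hplus, dist_comm]
      conv_lhs => rw [← mul_one (c (g⁻¹ ^ n) ξ)]
      rw [mul_one (c (g⁻¹ ^ n) ξ), ← hinvL (c (g⁻¹ ^ n) ξ) _ 1, mul_one]
    rw [e]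
    refine (holder_bound hS hδ B τ hτ0 hτ1 (c g⁻¹) (A g⁻¹) (hA _) (hHolder g⁻¹) _ _ _
      (hC ξ hξ n)).trans (le_of_eq ?_)
    have := hpw 0 C n
    rw [zero_add, Real.rpow_zero, mul_one] at this
    rw [this, mul_assoc]
  have hfin : ∀ ξ : B.pt, ξ ≠ minusPt B g →
      bgp B ξ (minusPt B g) ≤ ENNReal.ofReal (bgp B ξ (minusPt B g)).toReal := by
    intro ξ hξ
    rw [ENNReal.ofReal_toReal fun h => hξ (eq_of_bgp_top hS hδ B h)]
  have hlim : ∀ ξ : B.pt, ∃ l : G, ξ ≠ minusPt B g →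
      Tendsto (fun n : ℕ => c (g⁻¹ ^ n) ξ) atTop (𝓝 l) := by
    intro ξ
    by_cases hξ : ξ = minusPt B g
    · exact ⟨1, fun h => (h hξ).elim⟩
    obtain ⟨C, hC⟩ := hgeo _ (ENNReal.toReal_nonneg (a := bgp B ξ (minusPt B g)))
    have hcau := cauchySeq_of_le_geometric q C hq1 (hC ξ (hfin ξ hξ))
    obtain ⟨l, hl⟩ := cauchySeq_tendsto_of_complete hcau
    exact ⟨l, fun _ => hl⟩
  choose bg hbg using hlim
  have hne' : ∀ (r : ℝ) (ξ : B.pt), bgp B ξ (minusPt B g) ≤ ENNReal.ofReal r →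
      ξ ≠ minusPt B g := by
    rintro r ξ h rfl
    rw [bgp_self] at h
    exact ENNReal.ofReal_ne_top (top_le_iff.1 h)
  refine ⟨bg, hbg, ?_, ?_⟩
  · intro K hK hKne
    obtain ⟨r, hr, hKr⟩ := compact_bdd hS hδ B (minusPt B g) K hK hKne
    obtain ⟨C, hC⟩ := hgeo r hr.le
    rw [Metric.tendstoUniformlyOn_iff]
    intro ε hε
    have ht : Tendsto (fun n : ℕ => C * q ^ n / (1 - q)) atTop (𝓝 0) := by
      have := ((tendsto_pow_atTop_nhds_zero_of_lt_one hq0.le hq1).const_mul C).div_const (1 - q)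
      simpa using this
    filter_upwards [ht.eventually_lt_const hε] with n hn ξ hξ
    rw [dist_comm]
    exact (dist_le_of_le_geometric_of_tendsto q C hq1 (hC ξ (hKr ξ hξ))
      (hbg ξ (hKne ξ hξ)) n).trans_lt hn
  · intro r hr
    obtain ⟨C, -, hC⟩ := hexp r hr.le
    have h1q : 0 < 1 - q := by linarith
    have hτC : 0 < τ ^ (-C) := Real.rpow_pos_of_pos hτ0 _
    have hAg := hA g⁻¹
    refine ⟨A g⁻¹ * τ ^ (-C) / (1 - q), by positivity, ?_⟩
    intro ξ η hξ hη
    have hT : 0 < τ ^ (bgpR B ξ η) := Real.rpow_pos_of_pos hτ0 _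
    by_cases htop : bgp B ξ η = ⊤
    · rw [eq_of_bgp_top hS hδ B htop, dist_self]
      rw [eq_of_bgp_top hS hδ B htop] at hT
      positivity
    have hsum : ∀ n : ℕ, dist (c (g⁻¹ ^ n) ξ) (c (g⁻¹ ^ n) η) ≤
        A g⁻¹ * τ ^ (-C) * τ ^ (bgpR B ξ η) * ∑ k ∈ Finset.range n, q ^ k := by
      intro n
      induction n with
      | zero => simp [hc1]
      | succ n ih =>
        rw [hstep, hstep, Finset.sum_range_succ, mul_add]
        have e1 : dist (c (g⁻¹ ^ n) ξ * c g⁻¹ (B.smul (g ^ n) ξ))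
            (c (g⁻¹ ^ n) η * c g⁻¹ (B.smul (g ^ n) η)) ≤
            dist (c (g⁻¹ ^ n) ξ) (c (g⁻¹ ^ n) η) +
            dist (c g⁻¹ (B.smul (g ^ n) ξ)) (c g⁻¹ (B.smul (g ^ n) η)) := by
          refine (dist_triangle _ (c (g⁻¹ ^ n) η * c g⁻¹ (B.smul (g ^ n) ξ)) _).trans ?_
          rw [hinvL, hinvR]
        refine e1.trans (add_le_add ih ?_)
        refine (holder_bound hS hδ B τ hτ0 hτ1 (c g⁻¹) (A g⁻¹) (hA _) (hHolder g⁻¹) _ _ _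
          (hC ξ η hξ hη htop n)).trans (le_of_eq ?_)
        rw [hpw]; ring
    have hgs : ∀ n : ℕ, ∑ k ∈ Finset.range n, q ^ k ≤ (1 - q)⁻¹ := fun n =>
      sum_le_hasSum _ (fun k _ => by positivity) (hasSum_geometric_of_lt_one hq0.le hq1)
    have hd := (hbg ξ (hne' r ξ hξ)).dist (hbg η (hne' r η hη))
    refine le_of_tendsto' hd fun n => (hsum n).trans ?_
    have := mul_le_mul_of_nonneg_left (hgs n)
      (show 0 ≤ A g⁻¹ * τ ^ (-C) * τ ^ (bgpR B ξ η) by positivity)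
    refine this.trans (le_of_eq ?_)
    field_simp

end HarmonicBoundary
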